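/- Let a, b, c, d, e be positive integers, not all even, such that a + c + e and b + d are both even. Then the binary word W = 1^a 0^b 1^c 0^d 1^e is a shuffle square if and only if at least one of the following holds: (i) b = d and c ≤ a + e; (ii) b ≤ d, a ≥ c, and e is even; (iii) b ≥ d, c ≤ e, and a is even. -/

import Mathlib

/-- `Interleave x y z` means that `z` is an interleaving (shuffle) of the words
`x` and `y`. -/
inductive Interleave {α : Type*} : List α → List α → List α → Prop
  | nil : Interleave [] [] []
  | cons_left (a : α) {xs ys zs : List α} :
      Interleave xs ys zs → Interleave (a :: xs) ys (a :: zs)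
  | cons_right (a : α) {xs ys zs : List α} :
      Interleave xs ys zs → Interleave xs (a :: ys) (a :: zs)

/-- A word is a shuffle square if it is an interleaving of two copies of the same word. -/
def IsShuffleSquare {α : Type*} (w : List α) : Prop :=
  ∃ x : List α, Interleave x x w

theorem Interleave.append {α : Type*} {x y z x' y' z' : List α} (h : Interleave x y z)
    (h' : Interleave x' y' z') : Interleave (x ++ x') (y ++ y') (z ++ z') := by
  induction h with
  | nil => exact h'
  | cons_left a _ ih => exact .cons_left a ih
  | cons_right a _ ih => exact .cons_right a ih

theorem Interleave.exists_of_append {α : Type*} {u v x y : List α} (h : Interleave x y (u ++ v)) :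
    ∃ x₁ x₂ y₁ y₂, x = x₁ ++ x₂ ∧ y = y₁ ++ y₂ ∧ Interleave x₁ y₁ u ∧ Interleave x₂ y₂ v := by
  induction u generalizing x y with
  | nil => exact ⟨[], x, [], y, rfl, rfl, .nil, h⟩
  | cons s u ih =>
    cases h with
    | cons_left _ h =>
      obtain ⟨x₁, x₂, y₁, y₂, rfl, rfl, h₁, h₂⟩ := ih h
      exact ⟨s :: x₁, x₂, y₁, y₂, rfl, rfl, .cons_left s h₁, h₂⟩
    | cons_right _ h =>
      obtain ⟨x₁, x₂, y₁, y₂, rfl, rfl, h₁, h₂⟩ := ih h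
      exact ⟨x₁, x₂, s :: y₁, y₂, rfl, rfl, .cons_right s h₁, h₂⟩

theorem Interleave.replicate {α : Type*} (s : α) (i j : ℕ) :
    Interleave (List.replicate i s) (List.replicate j s) (List.replicate (i + j) s) := by
  induction i with
  | zero =>
    rw [Nat.zero_add]
    induction j with
    | zero => exact .nil
    | succ j ih => exact .cons_right s ih
  | succ i ih =>
    rw [Nat.succ_add]
    exact .cons_left s ih

theorem Interleave.exists_of_replicate {α : Type*} {s : α} {n : ℕ} {x y : List α}
    (h : Interleave x y (List.replicate n s)) :
    ∃ i j, i + j = n ∧ x = List.replicate i s ∧ y = List.replicate j s := by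
  induction n generalizing x y with
  | zero =>
    cases h
    exact ⟨0, 0, rfl, rfl, rfl⟩
  | succ n ih =>
    cases h with
    | cons_left _ h =>
      obtain ⟨i, j, rfl, rfl, rfl⟩ := ih h
      exact ⟨i + 1, j, by omega, rfl, rfl⟩
    | cons_right _ h =>
      obtain ⟨i, j, rfl, rfl, rfl⟩ := ih h
      exact ⟨i, j + 1, by omega, rfl, rfl⟩

theorem replicate_append_cons_inj {α : Type*} {s t : α} (hst : s ≠ t) {m n : ℕ} {l l' : List α} :
    List.replicate m s ++ t :: l = List.replicate n s ++ t :: l' ↔ m = n ∧ l = l' := by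
  induction m generalizing n with
  | zero => cases n <;> simp [List.replicate_succ, hst.symm]
  | succ m ih => cases n <;> simp [List.replicate_succ, hst, ih]

theorem replicate_append_replicate_append_inj {α : Type*} {s t : α} (hst : s ≠ t)
    {m n m' n' : ℕ} {l l' : List α} (hn : 0 < n) (hn' : 0 < n') :
    List.replicate m s ++ (List.replicate n t ++ l) =
        List.replicate m' s ++ (List.replicate n' t ++ l') ↔
      m = m' ∧ List.replicate n t ++ l = List.replicate n' t ++ l' := by
  obtain ⟨n, rfl⟩ := Nat.exists_eq_add_of_lt hn
  obtain ⟨n', rfl⟩ := Nat.exists_eq_add_of_lt hn'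
  simp [List.replicate_succ, replicate_append_cons_inj hst]

theorem replicate_append_replicate_inj {α : Type*} {s t : α} (hst : s ≠ t) {m n m' n' : ℕ} :
    List.replicate m s ++ List.replicate n t = List.replicate m' s ++ List.replicate n' t ↔
      m = m' ∧ n = n' := by
  induction m generalizing m' with
  | zero =>
    rcases m' with _ | m'
    · simp
    · cases n <;> simp [List.replicate_succ, hst.symm]
  | succ m ih =>
    rcases m' with _ | m'
    · cases n' <;> simp [List.replicate_succ, hst]
    · simpa [List.replicate_succ] using ih

theorem replicate_append_replicate_append_ne_replicate {α : Type*} {s t : α} (hst : s ≠ t)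
    {m n m' : ℕ} {l : List α} (hn : 0 < n) :
    List.replicate m s ++ (List.replicate n t ++ l) ≠ List.replicate m' s := by
  intro h
  have : t ∈ List.replicate m' s := h ▸ by simp [hn.ne']
  exact hst (List.eq_of_mem_replicate this).symm

theorem replicate_append_replicate_append_ne_append {α : Type*} {s t : α} (hst : s ≠ t)
    {m n k m' n' : ℕ} {l : List α} (hn : 0 < n) (hk : 0 < k) :
    List.replicate m s ++ (List.replicate n t ++ (List.replicate k s ++ l)) ≠
      List.replicate m' s ++ List.replicate n' t := by
  intro h
  rcases Nat.eq_zero_or_pos n' with rfl | hn'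
  · rw [List.replicate_zero, List.append_nil] at h
    exact replicate_append_replicate_append_ne_replicate hst hn h
  · rw [← List.append_nil (List.replicate n' t),
      replicate_append_replicate_append_inj hst hn hn', List.append_nil] at h
    exact replicate_append_replicate_append_ne_replicate hst.symm hk h.2

theorem replicate_ne_replicate_append_replicate_append {α : Type*} {s t : α} (hst : s ≠ t)
    {m n m' : ℕ} {l : List α} (hn : 0 < n) :
    List.replicate m' s ≠ List.replicate m s ++ (List.replicate n t ++ l) :=
  (replicate_append_replicate_append_ne_replicate hst hn).symm

theorem append_ne_replicate_append_replicate_append {α : Type*} {s t : α} (hst : s ≠ t)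
    {m n k m' n' : ℕ} {l : List α} (hn : 0 < n) (hk : 0 < k) :
    List.replicate m' s ++ List.replicate n' t ≠
      List.replicate m s ++ (List.replicate n t ++ (List.replicate k s ++ l)) :=
  (replicate_append_replicate_append_ne_append hst hn hk).symm

/-- The word `1^a 0^b 1^c 0^d 1^e`. -/
def fiveBlocks (a b c d e : ℕ) : List Bool :=
  List.replicate a true ++ List.replicate b false ++
    List.replicate c true ++ List.replicate d false ++ List.replicate e true

theorem isShuffleSquare_fiveBlocks_iff {a b c d e : ℕ} :
    IsShuffleSquare (fiveBlocks a b c d e) ↔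
      ∃ a₁ a₂ b₁ b₂ c₁ c₂ d₁ d₂ e₁ e₂, a₁ + a₂ = a ∧ b₁ + b₂ = b ∧ c₁ + c₂ = c ∧ d₁ + d₂ = d ∧
        e₁ + e₂ = e ∧ fiveBlocks a₁ b₁ c₁ d₁ e₁ = fiveBlocks a₂ b₂ c₂ d₂ e₂ := by
  constructor
  · rintro ⟨x, h⟩
    obtain ⟨_, _, _, _, hx, hy, h, he⟩ := h.exists_of_append
    obtain ⟨_, _, _, _, rfl, rfl, h, hd⟩ := h.exists_of_append
    obtain ⟨_, _, _, _, rfl, rfl, h, hc⟩ := h.exists_of_append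
    obtain ⟨_, _, _, _, rfl, rfl, ha, hb⟩ := h.exists_of_append
    obtain ⟨a₁, a₂, ha', rfl, rfl⟩ := ha.exists_of_replicate
    obtain ⟨b₁, b₂, hb', rfl, rfl⟩ := hb.exists_of_replicate
    obtain ⟨c₁, c₂, hc', rfl, rfl⟩ := hc.exists_of_replicate
    obtain ⟨d₁, d₂, hd', rfl, rfl⟩ := hd.exists_of_replicate
    obtain ⟨e₁, e₂, he', rfl, rfl⟩ := he.exists_of_replicate
    exact ⟨a₁, a₂, b₁, b₂, c₁, c₂, d₁, d₂, e₁, e₂, ha', hb', hc', hd', he', hx.symm.trans hy⟩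
  · rintro ⟨a₁, a₂, b₁, b₂, c₁, c₂, d₁, d₂, e₁, e₂, rfl, rfl, rfl, rfl, rfl, h⟩
    refine ⟨fiveBlocks a₁ b₁ c₁ d₁ e₁, ?_⟩
    nth_rewrite 2 [h]
    exact ((((Interleave.replicate true a₁ a₂).append (.replicate false b₁ b₂)).append
      (.replicate true c₁ c₂)).append (.replicate false d₁ d₂)).append (.replicate true e₁ e₂)

theorem shuffle_conditions_of_fiveBlocks_eq {a₁ a₂ b₁ b₂ c₁ c₂ d₁ d₂ e₁ e₂ : ℕ}
    (hb : 0 < b₁ + b₂) (hc : 0 < c₁ + c₂) (hd : 0 < d₁ + d₂)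
    (h : fiveBlocks a₁ b₁ c₁ d₁ e₁ = fiveBlocks a₂ b₂ c₂ d₂ e₂) :
    (a₁ = a₂ ∧ b₁ = b₂ ∧ c₁ = c₂ ∧ d₁ = d₂ ∧ e₁ = e₂) ∨
      (b₁ + b₂ = d₁ + d₂ ∧ c₁ + c₂ ≤ a₁ + a₂ + (e₁ + e₂)) ∨
      (b₁ + b₂ ≤ d₁ + d₂ ∧ c₁ + c₂ ≤ a₁ + a₂ ∧ e₁ = e₂) ∨
      (d₁ + d₂ ≤ b₁ + b₂ ∧ c₁ + c₂ ≤ e₁ + e₂ ∧ a₁ = a₂) := by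
  have hft : false ≠ true := by decide
  unfold fiveBlocks at h
  rcases Nat.eq_zero_or_pos b₁ with rfl | hb₁ <;> rcases Nat.eq_zero_or_pos b₂ with rfl | hb₂ <;>
    rcases Nat.eq_zero_or_pos c₁ with rfl | hc₁ <;> rcases Nat.eq_zero_or_pos c₂ with rfl | hc₂ <;>
    rcases Nat.eq_zero_or_pos d₁ with rfl | hd₁ <;> rcases Nat.eq_zero_or_pos d₂ with rfl | hd₂ <;>
    try omega
  all_goals
    simp (disch := omega) only [List.replicate_zero, List.append_nil, List.append_assoc,
      List.replicate_append_replicate,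
      replicate_append_replicate_append_inj hft, replicate_append_replicate_append_inj hft.symm,
      replicate_append_replicate_inj hft,
      replicate_append_replicate_append_ne_replicate hft.symm,
      replicate_ne_replicate_append_replicate_append hft.symm,
      replicate_append_replicate_append_ne_append hft,
      append_ne_replicate_append_replicate_append hft, and_false] at h
    try omega

theorem statement4 (a b c d e : ℕ)
    (ha : 0 < a) (hb : 0 < b) (hc : 0 < c) (hd : 0 < d) (he : 0 < e)
    (hnotall : ¬ (Even a ∧ Even b ∧ Even c ∧ Even d ∧ Even e))
    (hace : Even (a + c + e)) (hbd : Even (b + d)) :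
    IsShuffleSquare
        (List.replicate a true ++ List.replicate b false ++
          List.replicate c true ++ List.replicate d false ++ List.replicate e true) ↔
      (b = d ∧ c ≤ a + e) ∨
      (b ≤ d ∧ c ≤ a ∧ Even e) ∨
      (d ≤ b ∧ c ≤ e ∧ Even a) := by
  change IsShuffleSquare (fiveBlocks a b c d e) ↔ _
  rw [isShuffleSquare_fiveBlocks_iff]
  simp only [Nat.even_iff] at *
  constructor
  · rintro ⟨a₁, a₂, b₁, b₂, c₁, c₂, d₁, d₂, e₁, e₂, rfl, rfl, rfl, rfl, rfl, h⟩
    have := shuffle_conditions_of_fiveBlocks_eq hb hc hd h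
    omega
  · rintro (⟨rfl, h⟩ | ⟨h, h', h''⟩ | ⟨h, h', h''⟩)
    · obtain ⟨k, l, m, n, hk, hl, hc⟩ :
          ∃ k l m n, a = 2 * k + m ∧ e = 2 * l + n ∧ c = m + n := by
        by_cases hac : a ≤ c
        · exact ⟨0, (e + a - c) / 2, a, c - a, by omega⟩
        · exact ⟨(a - (c - (a + c) % 2)) / 2, (e - (a + c) % 2) / 2, c - (a + c) % 2,
            (a + c) % 2, by omega⟩
      refine ⟨k + m, k, b, 0, n, m, 0, b, l, l + n, by omega, by omega, by omega, by omega,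
        by omega, ?_⟩
      simp [fiveBlocks, Nat.add_comm l n, List.replicate_append_replicate]
    · refine ⟨(a + c) / 2, (a - c) / 2, b, 0, 0, c, (d - b) / 2, (d + b) / 2, e / 2, e / 2,
        by omega, by omega, by omega, by omega, by omega, ?_⟩
      have h₁ : (a + c) / 2 = (a - c) / 2 + c := by omega
      have h₂ : (d + b) / 2 = b + (d - b) / 2 := by omega
      simp [fiveBlocks, h₁, h₂, List.replicate_append_replicate]
    · refine ⟨a / 2, a / 2, (b - d) / 2, (b + d) / 2, 0, c, d, 0, (e + c) / 2, (e - c) / 2,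
        by omega, by omega, by omega, by omega, by omega, ?_⟩
      have h₁ : (e + c) / 2 = c + (e - c) / 2 := by omega
      have h₂ : (b + d) / 2 = (b - d) / 2 + d := by omega
      simp [fiveBlocks, h₁, h₂, List.replicate_append_replicate]
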